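/- Let P be a positive random field on X^{ℤ^d}. Suppose there exists a filtration F such that for each t ∈ ℤ^d there is a measurable set of admissible boundary conditions Y_t(F) ⊆ 𝒳_t(F) with P{ω : the restriction of ω to ℤ^d∖{t} lies in Y_t(F)} = 1, on which the limits g_t^{x̄}(x) are positive for all x ∈ X, and such that for all x, u ∈ X the one-point transition energy x̄ ↦ Δ_t^{x̄}(x,u) = ln(g_t^{x̄}(x)/g_t^{x̄}(u)) is quasilocal on Y_t(F). Then P is a Gibbs random field. -/

import Mathlib

open MeasureTheory Filter Topology

noncomputable section

/-- Sites of the lattice `ℤ^d`. -/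
abbrev Site (d : ℕ) := Fin d → ℤ

/-- Configurations on the whole lattice. -/
abbrev Config (d : ℕ) (X : Type*) := Site d → X

variable {d : ℕ} {X : Type*}

/-- The configuration equal to `x` on `V` and to `z` off `V` (the concatenation `xz`). -/
def concat (V : Finset (Site d)) (x z : Config d X) : Config d X :=
  fun t => if t ∈ V then x t else z t

/-- The configuration equal to `u` on `I` and to `y` off `I`. -/
def extCfg (I : Finset (Site d)) (u : {s // s ∈ I} → X) (y : Config d X) : Config d X :=
  fun t => if h : t ∈ I then u ⟨t, h⟩ else y t

/-- The cylinder set determined by the values of `z` on `Λ`. -/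
def cyl (Λ : Finset (Site d)) (z : Config d X) : Set (Config d X) :=
  {ω | ∀ t ∈ Λ, ω t = z t}

/-- Finite-dimensional distribution `P_Λ(z)`. -/
def fdd [MeasurableSpace X] (P : Measure (Config d X)) (Λ : Finset (Site d))
    (z : Config d X) : ℝ :=
  (P (cyl Λ z)).toReal

/-- A positive random field: all finite-dimensional distributions are positive. -/
def IsPositiveRF [MeasurableSpace X] (P : Measure (Config d X)) : Prop :=
  ∀ Λ : Finset (Site d), Λ.Nonempty → ∀ z : Config d X, 0 < fdd P Λ z

/-- Finite-conditional probability `g_V^z(x)` with boundary condition `z` on `Λ`. -/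
def gfin [MeasurableSpace X] (P : Measure (Config d X)) (V Λ : Finset (Site d))
    (x z : Config d X) : ℝ :=
  fdd P (V ∪ Λ) (concat V x z) / fdd P Λ z

/-- A filtration: an increasing sequence of finite subsets of the lattice with union `ℤ^d`. -/
structure Filt (d : ℕ) where
  Λ : ℕ → Finset (Site d)
  mono : Monotone Λ
  covers : ∀ t : Site d, ∃ n, t ∈ Λ n

/-- The set `𝒳_V(F)` of admissible boundary conditions: those `x̄` for which all the limits
`lim_n g_V^{x̄_{Λ_n ∖ V}}(x)` exist. (Only the values of `x̄` off `V` are ever used.) -/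
def admissible [MeasurableSpace X] (P : Measure (Config d X)) (V : Finset (Site d))
    (F : Filt d) : Set (Config d X) :=
  {xb | ∀ x : Config d X, ∃ L : ℝ,
    Tendsto (fun n => gfin P V (F.Λ n \ V) x xb) atTop (𝓝 L)}

/-- The conditional probability `g_V^{x̄}(x)` : the limit of `g_V^{x̄_{Λ_n ∖ V}}(x)`. -/
def gCond [MeasurableSpace X] (P : Measure (Config d X)) (V : Finset (Site d))
    (F : Filt d) (xb x : Config d X) : ℝ :=
  limUnder atTop (fun n => gfin P V (F.Λ n \ V) x xb)

/-- Transition energy `Δ_V^{x̄}(x,u) = ln (g_V^{x̄}(x) / g_V^{x̄}(u))`. -/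
def TE [MeasurableSpace X] (P : Measure (Config d X)) (V : Finset (Site d))
    (F : Filt d) (xb x u : Config d X) : ℝ :=
  Real.log (gCond P V F xb x / gCond P V F xb u)

/-- Quasilocality (on boundary conditions off `V`) of a function `h` on a set `Y` of
boundary conditions. -/
def QuasilocalOn (V : Finset (Site d)) (Y : Set (Config d X)) (h : Config d X → ℝ) : Prop :=
  ∀ ε > 0, ∃ Λε : Finset (Site d), Disjoint Λε V ∧
    ∀ Λ : Finset (Site d), Disjoint Λ V → Λε ⊆ Λ →
      ∀ xb ∈ Y, ∀ yb ∈ Y, (∀ s ∈ Λ, xb s = yb s) → |h xb - h yb| < ε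

/-- `Y` represents a set of boundary conditions on `ℤ^d ∖ {t}`: membership does not depend
on the value at `t`. -/
def IsBCSet (t : Site d) (Y : Set (Config d X)) : Prop :=
  ∀ (ω : Config d X) (a : X), ω ∈ Y → Function.update ω t a ∈ Y

/-- `F` is a determining filtration for `P` with sets `Y t` of admissible boundary conditions:
the one-point finite-conditional probabilities converge, uniformly over `Y t`, to positive
limits, and `P(Y t) = 1`. -/
structure IsDetermining [MeasurableSpace X] (P : Measure (Config d X)) (F : Filt d)
    (Y : Site d → Set (Config d X)) : Prop where
  meas : ∀ t, MeasurableSet (Y t)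
  bc : ∀ t, IsBCSet t (Y t)
  adm : ∀ t, Y t ⊆ admissible P {t} F
  full : ∀ t, P (Y t) = 1
  pos : ∀ t, ∀ xb ∈ Y t, ∀ x : X, 0 < gCond P {t} F xb (fun _ => x)
  unif : ∀ (t : Site d) (x : X), ∀ ε > 0, ∃ N, ∀ n ≥ N, ∀ xb ∈ Y t,
    |gfin P {t} (F.Λ n \ {t}) (fun _ => x) xb - gCond P {t} F xb (fun _ => x)| < ε

/-- The probabilistic (Pr--) definition of a Gibbs random field. -/
def IsGibbsRF [MeasurableSpace X] (P : Measure (Config d X)) : Prop :=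
  IsProbabilityMeasure P ∧ IsPositiveRF P ∧
    ∃ (F : Filt d) (Y : Site d → Set (Config d X)), IsDetermining P F Y

theorem cyl_congr {Λ : Finset (Site d)} {z w : Config d X} (h : ∀ s ∈ Λ, z s = w s) :
    cyl Λ z = cyl Λ w := by
  ext ω
  exact forall₂_congr fun s hs => by rw [h s hs]

theorem cyl_insert_concat {t : Site d} {Λ : Finset (Site d)} (ht : t ∉ Λ) (x z : Config d X) :
    cyl ({t} ∪ Λ) (concat {t} x z) = cyl Λ z ∩ {ω | ω t = x t} := by
  ext ω
  simp only [cyl, concat, Set.mem_ofPred_eq, Set.mem_inter_iff, Finset.mem_union,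
    Finset.mem_singleton]
  constructor
  · intro h
    refine ⟨fun s hs => ?_, by simpa using h t (Or.inl rfl)⟩
    have hst : s ≠ t := fun e => ht (e ▸ hs)
    simpa [hst] using h s (Or.inr hs)
  · rintro ⟨h, h'⟩ s hs
    by_cases hst : s = t
    · simpa [hst] using h'
    · simpa [hst] using h s (hs.resolve_left hst)

section

variable [MeasurableSpace X]

theorem measurableSet_cyl [MeasurableSingletonClass X] (Λ : Finset (Site d)) (z : Config d X) :
    MeasurableSet (cyl Λ z) := by
  have : cyl Λ z = ⋂ s ∈ Λ, (fun ω : Config d X => ω s) ⁻¹' {z s} := by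
    ext ω; simp [cyl]
  rw [this]
  exact Finset.measurableSet_biInter _ fun s _ => measurable_pi_apply s (measurableSet_singleton _)

theorem measurableSet_eval_eq [MeasurableSingletonClass X] (t : Site d) (a : X) :
    MeasurableSet {ω : Config d X | ω t = a} := by
  have h : Measurable fun ω : Config d X => ω t := measurable_pi_apply t
  exact h (measurableSet_singleton a)

theorem fdd_pos {P : Measure (Config d X)} [IsProbabilityMeasure P] (hP : IsPositiveRF P)
    (Λ : Finset (Site d)) (z : Config d X) : 0 < fdd P Λ z := by
  rcases Λ.eq_empty_or_nonempty with rfl | h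
  · simp [fdd, cyl]
  · exact hP Λ h z

theorem gfin_nonneg (P : Measure (Config d X)) (V Λ : Finset (Site d)) (x z : Config d X) :
    0 ≤ gfin P V Λ x z :=
  div_nonneg ENNReal.toReal_nonneg ENNReal.toReal_nonneg

theorem fdd_insert_concat (P : Measure (Config d X)) {t : Site d} {Λ : Finset (Site d)}
    (ht : t ∉ Λ) (x z : Config d X) :
    fdd P ({t} ∪ Λ) (concat {t} x z) = P.real (cyl Λ z ∩ {ω | ω t = x t}) := by
  rw [fdd, cyl_insert_concat ht, measureReal_def]

theorem gfin_le_one (P : Measure (Config d X)) [IsProbabilityMeasure P] {t : Site d}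
    {Λ : Finset (Site d)} (ht : t ∉ Λ) (x z : Config d X) : gfin P {t} Λ x z ≤ 1 := by
  refine div_le_one_of_le₀ ?_ ENNReal.toReal_nonneg
  rw [fdd_insert_concat P ht]
  exact measureReal_mono Set.inter_subset_left

theorem gfin_congr (P : Measure (Config d X)) {t : Site d} {Λ : Finset (Site d)} (ht : t ∉ Λ)
    (x : Config d X) {z w : Config d X} (h : ∀ s ∈ Λ, z s = w s) :
    gfin P {t} Λ x z = gfin P {t} Λ x w := by
  rw [gfin, gfin, fdd_insert_concat P ht, fdd_insert_concat P ht, fdd, fdd, cyl_congr h]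

/-- A function on configurations which depends on finitely many coordinates is measurable. -/
theorem measurable_of_local [Finite X] [Nonempty X] [MeasurableSingletonClass X]
    (Λ : Finset (Site d)) {f : Config d X → ℝ}
    (h : ∀ z w : Config d X, (∀ s ∈ Λ, z s = w s) → f z = f w) : Measurable f := by
  let z₀ : Config d X := fun _ => Classical.arbitrary X
  have hf : f = (fun u : {s // s ∈ Λ} → X => f (extCfg Λ u z₀)) ∘ fun ω s => ω s := by
    ext ω
    exact h _ _ fun s hs => by simp [extCfg, hs]
  rw [hf]
  exact (measurable_of_finite _).comp (by fun_prop)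

theorem measurable_gfin [Finite X] [Nonempty X] [MeasurableSingletonClass X]
    (P : Measure (Config d X)) {t : Site d} {Λ : Finset (Site d)} (ht : t ∉ Λ) (x : Config d X) :
    Measurable (gfin P {t} Λ x) :=
  measurable_of_local Λ fun _ _ => gfin_congr P ht x

theorem integrable_gfin [Finite X] [Nonempty X] [MeasurableSingletonClass X]
    (P : Measure (Config d X)) [IsProbabilityMeasure P] {t : Site d} {Λ : Finset (Site d)}
    (ht : t ∉ Λ) (x : Config d X) : Integrable (gfin P {t} Λ x) P :=
  Integrable.of_bound (measurable_gfin P ht x).aestronglyMeasurable 1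
    (Eventually.of_forall fun ω => by
      rw [Real.norm_of_nonneg (gfin_nonneg P _ _ _ _)]
      exact gfin_le_one P ht x ω)

/-- Averaging a one-point finite-conditional probability over the boundary conditions which
extend `z` gives back the joint probability. -/
theorem setIntegral_gfin [Finite X] [Nonempty X] [MeasurableSingletonClass X]
    {P : Measure (Config d X)} [IsProbabilityMeasure P] (hP : IsPositiveRF P) {t : Site d}
    {Λ Λ' : Finset (Site d)} (ht : t ∉ Λ') (hΛ : Λ ⊆ Λ') (x z : Config d X) :
    ∫ ω in cyl Λ z, gfin P {t} Λ' x ω ∂P = fdd P ({t} ∪ Λ) (concat {t} x z) := by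
  have := Fintype.ofFinite X
  let r : Config d X → ({s // s ∈ Λ'} → X) := fun ω s => ω s
  have hr : Measurable r := by fun_prop
  let S : ({s // s ∈ Λ'} → X) → Set (Config d X) := fun u => cyl Λ z ∩ r ⁻¹' {u}
  have hSm : ∀ u, MeasurableSet (S u) := fun u =>
    (measurableSet_cyl Λ z).inter (hr (measurableSet_singleton u))
  have hSd : Pairwise (Function.onFun Disjoint S) := fun u v huv =>
    Set.disjoint_left.2 fun ω hu hv => huv (hu.2.symm.trans hv.2)
  have hSU : cyl Λ z = ⋃ u, S u := by
    ext ω; simp [S]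
  rw [fdd_insert_concat P fun h => ht (hΛ h), hSU,
    integral_iUnion_fintype hSm hSd fun u => (integrable_gfin P ht x).integrableOn,
    Set.iUnion_inter, measureReal_iUnion_fintype
      (fun u v huv => (hSd huv).mono Set.inter_subset_left Set.inter_subset_left)
      fun u => (hSm u).inter (measurableSet_eval_eq t (x t))]
  refine Finset.sum_congr rfl fun u _ => ?_
  rcases (S u).eq_empty_or_nonempty with h | ⟨ω₀, h₀, h₁⟩
  · simp [h]
  have hS : S u = cyl Λ' ω₀ := by
    ext ω
    constructor
    · rintro ⟨-, h⟩ s hs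
      exact congrFun (h.trans h₁.symm) ⟨s, hs⟩
    · intro h
      refine ⟨fun s hs => (h s (hΛ hs)).trans (h₀ s hs), ?_⟩
      have : r ω = r ω₀ := funext fun s => h s s.2
      exact this.trans h₁
  rw [setIntegral_congr_fun (hSm u) (g := fun _ => gfin P {t} Λ' x ω₀), setIntegral_const, hS,
    ← fdd_insert_concat P ht]
  · exact mul_div_cancel₀ _ (fdd_pos hP Λ' ω₀).ne'
  · intro ω hω
    rw [hS] at hω
    exact gfin_congr P ht x hω

theorem sum_gfin [Fintype X] [MeasurableSingletonClass X] {P : Measure (Config d X)}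
    [IsProbabilityMeasure P] (hP : IsPositiveRF P) {t : Site d} {Λ : Finset (Site d)}
    (ht : t ∉ Λ) (z : Config d X) : ∑ u : X, gfin P {t} Λ (fun _ => u) z = 1 := by
  simp_rw [gfin, fdd_insert_concat P ht]
  rw [← Finset.sum_div, ← measureReal_iUnion_fintype, ← Set.inter_iUnion]
  · have : ⋃ u : X, {ω : Config d X | ω t = u} = Set.univ := by
      ext ω; simp
    rw [this, Set.inter_univ]
    exact div_self (fdd_pos hP Λ z).ne'
  · exact fun u v huv => Set.disjoint_left.2 fun ω hu hv => huv (hu.2.symm.trans hv.2)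
  · exact fun u => (measurableSet_cyl Λ z).inter (measurableSet_eval_eq t u)

theorem tendsto_gCond {P : Measure (Config d X)} {V : Finset (Site d)} {F : Filt d}
    {xb : Config d X} (h : xb ∈ admissible P V F) (x : Config d X) :
    Tendsto (fun n => gfin P V (F.Λ n \ V) x xb) atTop (𝓝 (gCond P V F xb x)) :=
  tendsto_nhds_limUnder (h x)

theorem sum_gCond [Fintype X] [MeasurableSingletonClass X] {P : Measure (Config d X)}
    [IsProbabilityMeasure P] (hP : IsPositiveRF P) {t : Site d} {F : Filt d}
    {xb : Config d X} (h : xb ∈ admissible P {t} F) :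
    ∑ u : X, gCond P {t} F xb (fun _ => u) = 1 := by
  refine tendsto_nhds_unique
    (tendsto_finsetSum Finset.univ fun u _ => tendsto_gCond h fun _ => u) ?_
  simp_rw [sum_gfin hP (show t ∉ _ \ {t} by simp)]
  exact tendsto_const_nhds

end

/-- Two positive probability vectors whose logarithmic ratios at `x` differ by at most
`log (1 + ε)` differ by at most `ε` at `x`. -/
theorem sub_le_of_log_ratio {ι : Type*} [Fintype ι] {p q : ι → ℝ} (hp : ∀ i, 0 < p i)
    (hq : ∀ i, 0 < q i) (hp1 : ∑ i, p i = 1) (hq1 : ∑ i, q i = 1) {ε : ℝ} (hε : 0 < ε) (x : ι)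
    (h : ∀ i, Real.log (q i / q x) - Real.log (p i / p x) ≤ Real.log (1 + ε)) :
    p x - q x ≤ ε := by
  have key : ∀ i, q i * p x ≤ (1 + ε) * q x * p i := fun i => by
    have h1 := h i
    rw [← Real.log_div (div_pos (hq i) (hq x)).ne' (div_pos (hp i) (hp x)).ne',
      Real.log_le_log_iff (div_pos (div_pos (hq i) (hq x)) (div_pos (hp i) (hp x)))
        (by linarith), div_div_div_eq, div_le_iff₀ (mul_pos (hq x) (hp i))] at h1
    linarith
  have hsum := Finset.sum_le_sum fun i (_ : i ∈ Finset.univ) => key i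
  rw [← Finset.sum_mul, ← Finset.mul_sum, hp1, hq1] at hsum
  have hqx : q x ≤ 1 := hq1 ▸ Finset.single_le_sum (fun i _ => (hq i).le) (Finset.mem_univ x)
  nlinarith

/-- Quasilocality of the one-point transition energies passes to the one-point conditional
probabilities. -/
theorem QuasilocalOn.gCond [Fintype X] [MeasurableSpace X] [MeasurableSingletonClass X]
    {P : Measure (Config d X)} [IsProbabilityMeasure P] (hP : IsPositiveRF P) {F : Filt d}
    {t : Site d} {Y : Set (Config d X)} (hadm : Y ⊆ admissible P {t} F)
    (hpos : ∀ xb ∈ Y, ∀ x : X, 0 < gCond P {t} F xb (fun _ => x)) (x : X)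
    (hql : ∀ u : X,
      QuasilocalOn {t} Y (fun xb => TE P {t} F xb (fun _ => u) (fun _ => x))) :
    QuasilocalOn {t} Y (fun xb => gCond P {t} F xb (fun _ => x)) := by
  intro ε hε
  have hlog : 0 < Real.log (1 + ε / 2) := Real.log_pos (by linarith)
  choose Λε hd hΛε using fun u => hql u _ hlog
  refine ⟨Finset.univ.biUnion Λε, (Finset.disjoint_biUnion_left _ _ _).2 fun u _ => hd u,
    fun Λ hΛ hsub xb hxb yb hyb hxy => ?_⟩
  have hTE := fun u => abs_lt.1 (hΛε u Λ hΛ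
    ((Finset.subset_biUnion_of_mem Λε (Finset.mem_univ u)).trans hsub) xb hxb yb hyb hxy)
  have hle : ∀ a b : ℝ, a - b ≤ ε / 2 → b - a ≤ ε / 2 → |a - b| < ε := fun a b h₁ h₂ =>
    abs_lt.2 ⟨by linarith, by linarith⟩
  refine hle _ _ ?_ ?_
  · exact sub_le_of_log_ratio (p := fun u => _root_.gCond P {t} F xb fun _ => u)
      (q := fun u => _root_.gCond P {t} F yb fun _ => u) (hpos xb hxb) (hpos yb hyb)
      (sum_gCond hP (hadm hxb)) (sum_gCond hP (hadm hyb)) (half_pos hε) x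
      fun u => by have := (hTE u).1; simp only [TE] at this; linarith
  · exact sub_le_of_log_ratio (p := fun u => _root_.gCond P {t} F yb fun _ => u)
      (q := fun u => _root_.gCond P {t} F xb fun _ => u) (hpos yb hyb) (hpos xb hxb)
      (sum_gCond hP (hadm hyb)) (sum_gCond hP (hadm hxb)) (half_pos hε) x
      fun u => by have := (hTE u).2; simp only [TE] at this; linarith

theorem Filt.exists_subset (F : Filt d) (Λ : Finset (Site d)) : ∃ N, ∀ n ≥ N, Λ ⊆ F.Λ n := by
  choose N hN using F.covers
  exact ⟨Λ.sup N, fun n hn s hs => F.mono ((Finset.le_sup hs).trans hn) (hN s)⟩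

/-- A finite-conditional probability is within `ε` of `c` if almost all the conditional
probabilities that it averages are. -/
theorem abs_gfin_sub_le [Finite X] [Nonempty X] [MeasurableSpace X] [MeasurableSingletonClass X]
    {P : Measure (Config d X)} [IsProbabilityMeasure P] (hP : IsPositiveRF P) {F : Filt d}
    {t : Site d} (hadm : ∀ᵐ ω ∂P, ω ∈ admissible P {t} F) (x z : Config d X) (n : ℕ) {c ε : ℝ}
    (h : ∀ᵐ ω ∂P, ω ∈ cyl (F.Λ n \ {t}) z → |gCond P {t} F ω x - c| ≤ ε) :
    |gfin P {t} (F.Λ n \ {t}) x z - c| ≤ ε := by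
  have ht : ∀ m, t ∉ F.Λ m \ {t} := fun m => by simp
  set A := cyl (F.Λ n \ {t}) z with hA
  have hpos : 0 < P.real A := fdd_pos hP (F.Λ n \ {t}) z
  have hlim : Tendsto (fun m => ∫ ω in A, (gfin P {t} (F.Λ m \ {t}) x ω - c) ∂P) atTop
      (𝓝 (∫ ω in A, (gCond P {t} F ω x - c) ∂P)) := by
    refine tendsto_integral_of_dominated_convergence (fun _ => 1 + |c|)
      (fun m => ((measurable_gfin P (ht m) x).sub_const c).aestronglyMeasurable)
      (integrable_const _) (fun m => Eventually.of_forall fun ω => ?_)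
      (ae_restrict_of_ae (hadm.mono fun ω hω => (tendsto_gCond hω x).sub_const c))
    refine (norm_sub_le _ _).trans (add_le_add_left ?_ _)
    rw [Real.norm_of_nonneg (gfin_nonneg P _ _ _ _)]
    exact gfin_le_one P (ht m) x ω
  have hev : ∀ᶠ m in atTop, ∫ ω in A, (gfin P {t} (F.Λ m \ {t}) x ω - c) ∂P =
      (gfin P {t} (F.Λ n \ {t}) x z - c) * P.real A := by
    filter_upwards [eventually_ge_atTop n] with m hm
    rw [integral_sub (integrable_gfin P (ht m) x).integrableOn (integrable_const c),
      setIntegral_gfin hP (ht m) (Finset.sdiff_subset_sdiff (F.mono hm) subset_rfl),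
      setIntegral_const, sub_mul, smul_eq_mul, mul_comm c]
    congr 1
    exact (div_mul_cancel₀ _ hpos.ne').symm
  have heq := tendsto_nhds_unique hlim ((tendsto_congr' hev).2 tendsto_const_nhds)
  have hb := norm_setIntegral_le_of_norm_le_const_ae'
    (f := fun ω => gCond P {t} F ω x - c) (measure_lt_top P A) h
  rw [heq, norm_mul, Real.norm_of_nonneg hpos.le] at hb
  exact le_of_mul_le_mul_right hb hpos

/-- Proposition 5 / `prop-crit-Gibbs-2`: quasilocality of one-point
transition energies implies Gibbsianness. -/
theorem stmt13 [Fintype X] [Nontrivial X] [MeasurableSpace X] [MeasurableSingletonClass X]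
    (P : Measure (Config d X)) [IsProbabilityMeasure P] (hP : IsPositiveRF P)
    (F : Filt d) (Y : Site d → Set (Config d X))
    (hmeas : ∀ t, MeasurableSet (Y t)) (hbc : ∀ t, IsBCSet t (Y t))
    (hadm : ∀ t, Y t ⊆ admissible P {t} F) (hfull : ∀ t, P (Y t) = 1)
    (hpos : ∀ t, ∀ xb ∈ Y t, ∀ x : X, 0 < gCond P {t} F xb (fun _ => x))
    (hql : ∀ (t : Site d) (x u : X),
      QuasilocalOn {t} (Y t)
        (fun xb => TE P {t} F xb (fun _ => x) (fun _ => u))) :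
    IsGibbsRF P := by
  refine ⟨inferInstance, hP, F, Y, hmeas, hbc, hadm, hfull, hpos, fun t x ε hε => ?_⟩
  have hae : ∀ᵐ ω ∂P, ω ∈ Y t := (mem_ae_iff_prob_eq_one (hmeas t)).2 (hfull t)
  obtain ⟨Λε, hd, hΛε⟩ := QuasilocalOn.gCond hP (hadm t) (hpos t) x (fun u => hql t u x)
    (ε / 2) (half_pos hε)
  obtain ⟨N, hN⟩ := F.exists_subset Λε
  refine ⟨N, fun n hn xb hxb => lt_of_le_of_lt (abs_gfin_sub_le hP
    (hae.mono fun ω hω => hadm t hω) _ xb n ?_) (half_lt_self hε)⟩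
  filter_upwards [hae] with ω hω hcyl
  exact (hΛε (F.Λ n \ {t}) Finset.sdiff_disjoint
    (Finset.subset_sdiff.2 ⟨hN n hn, hd⟩) ω hω xb hxb hcyl).le
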